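/- arXiv:1902.03333 — 2 statements merged into one kernel-verified Lean document; each statement's English description precedes it below -/
import Mathlib

section
/- The dual complex C(b_1,…,b_n)^∨ = Hom_R(C(b_1,…,b_n), R) of a standard complex is isomorphic, as a bigraded chain complex over R, to the standard complex C(−b_1,…,−b_n). -/
/-!
Common setup: the ring `R = 𝔽₂[U,V]/(UV = 0)`, bigraded free finitely generated chain
complexes over `R` ("pre-complexes"), knot-like complexes, local maps and local
equivalence, standard and semistandard complexes, short maps, the `Z^!` order,
the invariants `a_i`, `φ_j`, `P`, shift maps, tensor products, duals, and direct sums.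
-/

set_option synthInstance.maxHeartbeats 1000000
set_option maxHeartbeats 1000000

noncomputable section

/-- The polynomial ring `𝔽₂[U,V]`. -/
abbrev PolyUV : Type := MvPolynomial (Fin 2) (ZMod 2)

/-- The ideal `(U·V)`. -/
def IUV : Ideal PolyUV := Ideal.span {(MvPolynomial.X 0 * MvPolynomial.X 1 : PolyUV)}

/-- The ring `R = 𝔽₂[U,V]/(UV = 0)`. -/
abbrev RUV : Type := PolyUV ⧸ IUV

instance : CommRing RUV := Ideal.Quotient.commRing IUV

/-- The image of `U` in `R`. -/
def Uv : RUV := Ideal.Quotient.mk IUV (MvPolynomial.X 0)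

/-- The image of `V` in `R`. -/
def Vv : RUV := Ideal.Quotient.mk IUV (MvPolynomial.X 1)

/-- `r ∈ R` is homogeneous of bidegree `(p, q)` for the bigrading with
`gr(U) = (-2, 0)`, `gr(V) = (0, -2)`, `gr(1) = (0, 0)` (coefficients in `𝔽₂`). -/
def IsHomog (r : RUV) (p q : ℤ) : Prop :=
  r = 0 ∨ (∃ a : ℕ, r = Uv ^ a ∧ p = -(2 * (a : ℤ)) ∧ q = 0) ∨
    (∃ b : ℕ, r = Vv ^ b ∧ p = 0 ∧ q = -(2 * (b : ℤ)))

/-- A finitely generated free bigraded module over `R` with a distinguished basis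
indexed by `Fin n`, together with a bigrading `gr` on the basis and a matrix `dm`
recording a prospective differential: `dm i j` is the coefficient of the `j`-th basis
vector in the differential of the `i`-th basis vector. -/
structure PreCx where
  n : ℕ
  gr : Fin n → ℤ × ℤ
  dm : Fin n → Fin n → RUV

/-- The underlying free `R`-module of a pre-complex. -/
abbrev Msub (C : PreCx) : Type := Fin C.n →₀ RUV

/-- The differential of a pre-complex, as an `R`-linear map. -/
def dmap (C : PreCx) : Msub C →ₗ[RUV] Msub C :=
  Finsupp.linearCombination RUV fun i => ∑ j, Finsupp.single j (C.dm i j)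

/-- The submodule `U·C ⊆ C`; `C/U` is the quotient by this submodule. -/
def uSub (C : PreCx) : Submodule RUV (Msub C) :=
  LinearMap.range (LinearMap.lsmul RUV (Msub C) Uv)

/-- The submodule `V·C ⊆ C`; `C/V` is the quotient by this submodule. -/
def vSub (C : PreCx) : Submodule RUV (Msub C) :=
  LinearMap.range (LinearMap.lsmul RUV (Msub C) Vv)

/-- Chains which die in the homology of `C/U`: the preimage in `C` of the boundaries of
the induced differential on `C/U`. -/
def bdryU (C : PreCx) : Submodule RUV (Msub C) := uSub C ⊔ LinearMap.range (dmap C)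

/-- Chains which die in the homology of `C/V`. -/
def bdryV (C : PreCx) : Submodule RUV (Msub C) := vSub C ⊔ LinearMap.range (dmap C)

/-- A chain `x ∈ C` is homogeneous of bidegree `(p, q)`. -/
def ChainHomog (C : PreCx) (x : Msub C) (p q : ℤ) : Prop :=
  ∀ j, IsHomog (x j) (p - (C.gr j).1) (q - (C.gr j).2)

/-- `x` is a `V`-tower class generator: its class in `H_*(C/U)` is a `V`-nontorsion cycle
whose image generates `H_*(C/U)/(V-torsion)` (equivalently, it is maximally `V`-graded
among `V`-nontorsion classes). -/
def IsVTowerGen (C : PreCx) (x : Msub C) : Prop :=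
  dmap C x ∈ uSub C ∧ (∀ k : ℕ, Vv ^ k • x ∉ bdryU C) ∧
    ∀ z : Msub C, dmap C z ∈ uSub C →
      ∃ (r : RUV) (k : ℕ), Vv ^ k • (z - r • x) ∈ bdryU C

/-- `x` is a `U`-tower class generator: its class in `H_*(C/V)` is a `U`-nontorsion cycle
whose image generates `H_*(C/V)/(U-torsion)`. -/
def IsUTowerGen (C : PreCx) (x : Msub C) : Prop :=
  dmap C x ∈ vSub C ∧ (∀ k : ℕ, Uv ^ k • x ∉ bdryV C) ∧
    ∀ z : Msub C, dmap C z ∈ vSub C →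
      ∃ (r : RUV) (k : ℕ), Uv ^ k • (z - r • x) ∈ bdryV C

/-- `C` is a chain complex over `R` whose differential has degree `(-1, -1)`. -/
def IsCplx (C : PreCx) : Prop :=
  (∀ x, dmap C (dmap C x) = 0) ∧
    ∀ i j, IsHomog (C.dm i j) ((C.gr i).1 - 1 - (C.gr j).1) ((C.gr i).2 - 1 - (C.gr j).2)

/-- A knot-like complex: a free, finitely generated, bigraded chain complex over `R`
whose differential has degree `(-1,-1)`, such that `H_*(C/U)/(V`-torsion`) ≅ 𝔽₂[V]` with
all `V`-nontorsion elements of `H_*(C/U)` in `U`-grading `0`, and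
`H_*(C/V)/(U`-torsion`) ≅ 𝔽₂[U]` with all `U`-nontorsion elements of `H_*(C/V)` in
`V`-grading `0`. -/
structure IsKnotLike (C : PreCx) : Prop where
  dsq : ∀ x, dmap C (dmap C x) = 0
  dhomog : ∀ i j, IsHomog (C.dm i j)
    ((C.gr i).1 - 1 - (C.gr j).1) ((C.gr i).2 - 1 - (C.gr j).2)
  vTowerExists : ∃ x, IsVTowerGen C x
  vTowerGr : ∀ x p q, ChainHomog C x p q → dmap C x ∈ uSub C →
    (∀ k : ℕ, Vv ^ k • x ∉ bdryU C) → p = 0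
  uTowerExists : ∃ x, IsUTowerGen C x
  uTowerGr : ∀ x p q, ChainHomog C x p q → dmap C x ∈ vSub C →
    (∀ k : ℕ, Uv ^ k • x ∉ bdryV C) → q = 0

/-- A module map `f : C₁ → C₂` is homogeneous of bidegree `(s, t)`. -/
def MapHomogShift (C₁ C₂ : PreCx) (f : Msub C₁ →ₗ[RUV] Msub C₂) (s t : ℤ) : Prop :=
  ∀ i j, IsHomog (f (Finsupp.single i 1) j)
    ((C₁.gr i).1 + s - (C₂.gr j).1) ((C₁.gr i).2 + t - (C₂.gr j).2)

/-- A local map `f : C₁ → C₂`: an absolutely `U`-graded, relatively `V`-graded,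
`R`-equivariant chain map inducing an isomorphism on `H_*(·/U)/(V-torsion)`
(equivalently, taking `V`-tower generators to `V`-tower generators). -/
structure IsLocalMap (C₁ C₂ : PreCx) (f : Msub C₁ →ₗ[RUV] Msub C₂) : Prop where
  chain : ∀ x, f (dmap C₁ x) = dmap C₂ (f x)
  graded : ∃ s : ℤ, MapHomogShift C₁ C₂ f 0 s
  towers : ∀ x, IsVTowerGen C₁ x → IsVTowerGen C₂ (f x)

/-- `C₁ ≤ C₂`: there exists a local map `C₁ → C₂`. -/
def LocalLE (C₁ C₂ : PreCx) : Prop := ∃ f, IsLocalMap C₁ C₂ f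

/-- Local equivalence of complexes: local maps in both directions. -/
def LocalEquiv (C₁ C₂ : PreCx) : Prop := LocalLE C₁ C₂ ∧ LocalLE C₂ C₁

/-- `C` is reduced: `∂ ≡ 0 mod (U, V)`. -/
def Reduced (C : PreCx) : Prop := ∀ i j, C.dm i j ∈ Ideal.span ({Uv, Vv} : Set RUV)

/-! ### Standard complexes -/

/-- The shift in bigrading from `x_k` to `x_{k+1}` in a standard complex, where the
parameter joining them is `b` (`k` is the 0-based index of the parameter, so the
parameter is a `U`-power arrow if `k` is even and a `V`-power arrow if `k` is odd). -/
def stepShift (k : ℕ) (b : ℤ) : ℤ × ℤ :=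
  if k % 2 = 0 then
    if b < 0 then (2 * (b.natAbs : ℤ) - 1, -1) else (1 - 2 * (b.natAbs : ℤ), 1)
  else
    if b < 0 then (-1, 2 * (b.natAbs : ℤ) - 1) else (1, 1 - 2 * (b.natAbs : ℤ))

/-- Bigrading of `x_i` relative to `x_0` in the standard complex with parameters `L`. -/
def grRel (L : List ℤ) (i : ℕ) : ℤ × ℤ :=
  ∑ k ∈ Finset.range i, stepShift k (L.getD k 0)

/-- The bigrading of the standard complex of parameters `L`, normalized so that
`gr_U(x_0) = 0` and `gr_V(x_n) = 0`. -/
def stdGr (L : List ℤ) (i : Fin (L.length + 1)) : ℤ × ℤ :=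
  ((grRel L (i : ℕ)).1, (grRel L (i : ℕ)).2 - (grRel L L.length).2)

/-- The differential matrix of the standard complex of parameters `L = (b_1, …, b_n)`:
for `i` odd (1-based), `∂_U x_{i-1} = U^{|b_i|} x_i` if `b_i < 0` and
`∂_U x_i = U^{b_i} x_{i-1}` if `b_i > 0`; for `i` even the same with `V` in place of `U`;
all other differentials vanish. -/
def stdDm (L : List ℤ) (i j : Fin (L.length + 1)) : RUV :=
  if (j : ℕ) = (i : ℕ) + 1 ∧ L.getD (i : ℕ) 0 < 0 then
    (if (i : ℕ) % 2 = 0 then Uv else Vv) ^ (L.getD (i : ℕ) 0).natAbs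
  else if (i : ℕ) = (j : ℕ) + 1 ∧ 0 < L.getD (j : ℕ) 0 then
    (if (j : ℕ) % 2 = 0 then Uv else Vv) ^ (L.getD (j : ℕ) 0).natAbs
  else 0

/-- The standard complex `C(b_1, …, b_n)` of a list of parameters `L = (b_1, …, b_n)`,
with generators `x_0, …, x_n`.  (For `L = []` this is the trivial complex `R`.) -/
def StdCx (L : List ℤ) : PreCx := ⟨L.length + 1, stdGr L, stdDm L⟩

/-- `L` is a valid parameter sequence for a standard complex: all entries are nonzero
and the length is even (possibly zero). -/
def IsStdSeq (L : List ℤ) : Prop := (∀ b ∈ L, b ≠ 0) ∧ Even L.length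

/-- The trivial standard complex `C(0) = R`. -/
def trivCx : PreCx := StdCx []

/-- The bigrading of the semistandard complex `C'(b_1, …, b_n)` (`n` odd), inherited from
the ambient standard complex `C(b_1, …, b_n, 1)`. -/
def semiGr (L : List ℤ) (i : Fin (L.length + 1)) : ℤ × ℤ :=
  ((grRel L (i : ℕ)).1, (grRel L (i : ℕ)).2 - (grRel L L.length).2 + 1)

/-- The semistandard complex `C'(b_1, …, b_n)` (`n` odd): the subcomplex of
`C(b_1, …, b_n, 1)` generated by `x_0, …, x_n`. -/
def SemiStdCx (L : List ℤ) : PreCx := ⟨L.length + 1, semiGr L, stdDm L⟩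

/-! ### Tensor products, duals, direct sums -/

/-- The tensor product (over `R`) of two pre-complexes, with basis `x_i ⊗ y_j` and
differential `∂(x ⊗ y) = ∂x ⊗ y + x ⊗ ∂y` (signs are irrelevant in characteristic 2). -/
def tensorCx (C₁ C₂ : PreCx) : PreCx where
  n := C₁.n * C₂.n
  gr := fun p => C₁.gr (finProdFinEquiv.symm p).1 + C₂.gr (finProdFinEquiv.symm p).2
  dm := fun p q =>
    (if (finProdFinEquiv.symm p).2 = (finProdFinEquiv.symm q).2 then
      C₁.dm (finProdFinEquiv.symm p).1 (finProdFinEquiv.symm q).1 else 0) +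
    (if (finProdFinEquiv.symm p).1 = (finProdFinEquiv.symm q).1 then
      C₂.dm (finProdFinEquiv.symm p).2 (finProdFinEquiv.symm q).2 else 0)

/-- The dual complex `C^∨ = Hom_R(C, R)`, described on the dual basis: the gradings are
negated and the differential matrix is transposed. -/
def dualCx (C : PreCx) : PreCx := ⟨C.n, fun i => -C.gr i, fun i j => C.dm j i⟩

/-- The direct sum of two pre-complexes. -/
def sumCx (C₁ C₂ : PreCx) : PreCx where
  n := C₁.n + C₂.n
  gr := fun p => Sum.elim C₁.gr C₂.gr (finSumFinEquiv.symm p)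
  dm := fun p q =>
    match finSumFinEquiv.symm p, finSumFinEquiv.symm q with
    | Sum.inl i, Sum.inl k => C₁.dm i k
    | Sum.inr j, Sum.inr l => C₂.dm j l
    | _, _ => 0

/-- A homotopy equivalence of bigraded chain complexes over `R`: chain maps `f, g`
preserving the bigrading, with `g ∘ f ≃ id` and `f ∘ g ≃ id` via `R`-equivariant
homotopies of bidegree `(1, 1)`. -/
def HomotopyEquivCx (C₁ C₂ : PreCx) : Prop :=
  ∃ (f : Msub C₁ →ₗ[RUV] Msub C₂) (g : Msub C₂ →ₗ[RUV] Msub C₁)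
    (H : Msub C₁ →ₗ[RUV] Msub C₁) (K : Msub C₂ →ₗ[RUV] Msub C₂),
    (∀ x, f (dmap C₁ x) = dmap C₂ (f x)) ∧
    (∀ y, g (dmap C₂ y) = dmap C₁ (g y)) ∧
    MapHomogShift C₁ C₂ f 0 0 ∧ MapHomogShift C₂ C₁ g 0 0 ∧
    MapHomogShift C₁ C₁ H 1 1 ∧ MapHomogShift C₂ C₂ K 1 1 ∧
    (∀ x, g (f x) - x = dmap C₁ (H x) + H (dmap C₁ x)) ∧
    (∀ y, f (g y) - y = dmap C₂ (K y) + K (dmap C₂ y))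

/-- An isomorphism of bigraded chain complexes over `R`. -/
def IsBigradedChainIso (C₁ C₂ : PreCx) (f : Msub C₁ →ₗ[RUV] Msub C₂) : Prop :=
  Function.Bijective f ∧ (∀ x, f (dmap C₁ x) = dmap C₂ (f x)) ∧ MapHomogShift C₁ C₂ f 0 0

/-! ### Short maps -/

/-- A short map `f : C(b_1, …, b_n) ⇝ C`: an absolutely `U`-graded, relatively
`V`-graded `R`-module map which is a chain map at `x_1, …, x_{n-1}` and commutes with
the `V`-part of the differential at `x_n` (for reduced `C`, the failure
`∂ f(x_n) - f(∂_V x_n)` is exactly `∂_U f(x_n) ∈ U·C`). -/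
def IsShortMap (L : List ℤ) (C : PreCx) (f : Msub (StdCx L) →ₗ[RUV] Msub C) : Prop :=
  (∃ s : ℤ, MapHomogShift (StdCx L) C f 0 s) ∧
  (∀ i : Fin (L.length + 1), 1 ≤ (i : ℕ) → (i : ℕ) + 1 ≤ L.length →
    f (dmap (StdCx L) (Finsupp.single i 1)) = dmap C (f (Finsupp.single i 1))) ∧
  dmap C (f (Finsupp.single (Fin.last L.length) 1)) -
    f (dmap (StdCx L) (Finsupp.single (Fin.last L.length) 1)) ∈ uSub C

/-- A short local map: a short map sending the `V`-tower generator `x_0` to a `V`-tower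
generator (hence inducing an isomorphism on `H_*(·/U)/(V-torsion)`). -/
def IsShortLocalMap (L : List ℤ) (C : PreCx) (f : Msub (StdCx L) →ₗ[RUV] Msub C) : Prop :=
  IsShortMap L C f ∧ IsVTowerGen C (f (Finsupp.single (0 : Fin (L.length + 1)) 1))

/-- A local map from the semistandard complex `C'(b_1, …, b_n)` to a knot-like complex:
a grading-preserving `R`-equivariant chain map under which the class of `x_0`
generates `H_*(C/U)/(V-torsion)`. -/
def IsSemiLocalMap (L : List ℤ) (C : PreCx) (f : Msub (SemiStdCx L) →ₗ[RUV] Msub C) : Prop :=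
  (∀ x, f (dmap (SemiStdCx L) x) = dmap C (f x)) ∧
  MapHomogShift (SemiStdCx L) C f 0 0 ∧
  IsVTowerGen C (f (Finsupp.single (0 : Fin (L.length + 1)) 1))

/-! ### The order `Z^!` and the numerical invariants -/

/-- The embedding of `Z^!` into `ℚ` realizing the order
`-1 <^! -2 <^! ⋯ <^! 0 <^! ⋯ <^! 2 <^! 1`: send `0 ↦ 0` and `a ↦ 1/a` otherwise. -/
def qval (a : ℤ) : ℚ := if a = 0 then 0 else 1 / (a : ℚ)

/-- The order `≤^!` on `Z^!`. -/
def bangLE (a b : ℤ) : Prop := qval a ≤ qval b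

/-- Pad a finite sequence with trailing zeros. -/
def seqPad (L : List ℤ) (i : ℕ) : ℤ := L.getD i 0

/-- The lexicographic order on finite integer sequences induced by `≤^!`, padding the
shorter sequence with trailing zeros. -/
def bangLexLE (L₁ L₂ : List ℤ) : Prop :=
  (∀ i, seqPad L₁ i = seqPad L₂ i) ∨
    ∃ k, (∀ i < k, seqPad L₁ i = seqPad L₂ i) ∧ qval (seqPad L₁ k) < qval (seqPad L₂ k)

/-- `m` is an upper bound for `S ⊆ Z^!` with respect to `≤^!`. -/
def IsBangUB (S : Set ℤ) (m : ℤ) : Prop := ∀ b ∈ S, qval b ≤ qval m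

/-- `m = sup^! S`, the least upper bound of `S ⊆ Z^!` with respect to `≤^!`. -/
def IsBangLUB (S : Set ℤ) (m : ℤ) : Prop :=
  IsBangUB S m ∧ ∀ m' : ℤ, IsBangUB S m' → qval m ≤ qval m'

/-- Candidate set for the next invariant: given the already-constructed prefix `P`,
those nonzero `b` such that some standard complex `C(P, b, rest) ≤ C`. -/
def candSet (C : PreCx) (P : List ℤ) : Set ℤ :=
  {b | b ≠ 0 ∧ ∃ rest : List ℤ, IsStdSeq (P ++ b :: rest) ∧ LocalLE (StdCx (P ++ b :: rest)) C}

/-- `a` is the sequence of numerical invariants `a_i(C)` (indexed from `0`):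
once a term vanishes all later terms vanish, and otherwise each term is
`sup^!` of the corresponding candidate set. -/
def InvSeq (C : PreCx) (a : ℕ → ℤ) : Prop :=
  ∀ k : ℕ,
    ((∃ i < k, a i = 0) → a k = 0) ∧
    ((∀ i < k, a i ≠ 0) → IsBangLUB (candSet C ((List.range k).map a)) (a k))

/-- The first `n` terms of `a`, with the (all-zero) tail deleted. -/
def truncSeq (a : ℕ → ℤ) (n : ℕ) : List ℤ :=
  ((List.range n).map a).takeWhile (fun b => b != 0)

/-! ### The homomorphisms `φ_j`, `P` and the shifts `sh_m` -/

/-- `φ_j` of a standard complex `C(a_1, …, a_n)`: the signed count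
`#{i odd : a_i = j} − #{i odd : a_i = −j}` (with 1-based odd `i`). -/
def phi (j : ℕ) (L : List ℤ) : ℤ :=
  ∑ i ∈ Finset.range L.length,
    if i % 2 = 0 then
      (if L.getD i 0 = (j : ℤ) then 1 else 0) - (if L.getD i 0 = -(j : ℤ) then 1 else 0)
    else 0

/-- The shift `sh_m` on parameter sequences: entries of absolute value `≥ m` are pushed
one further from zero; entries of absolute value `< m` are fixed. -/
def shSeq (m : ℕ) (L : List ℤ) : List ℤ :=
  L.map fun a => if (m : ℤ) ≤ a then a + 1 else if a ≤ -(m : ℤ) then a - 1 else a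

/-- `P(C) = -2 ∑_{j>0} j φ_j(C) + ∑_i sgn a_i`, computed from the parameter sequence of
the standard representative (the sum over `j` is finite since `φ_j` vanishes for
`j` larger than any `|a_i|`). -/
def Pval (L : List ℤ) : ℤ :=
  -2 * (∑ j ∈ Finset.range ((L.map Int.natAbs).sum + 1), (j : ℤ) * phi j L) +
    (L.map Int.sign).sum

end

/-- A grading- and differential-preserving bijection between the distinguished bases of two
pre-complexes induces an isomorphism of bigraded chain complexes. -/
lemma isBigradedChainIso_domLCongr {C₁ C₂ : PreCx} (e : Fin C₁.n ≃ Fin C₂.n)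
    (hgr : ∀ i, C₂.gr (e i) = C₁.gr i) (hdm : ∀ i j, C₂.dm (e i) (e j) = C₁.dm i j) :
    IsBigradedChainIso C₁ C₂ (Finsupp.domLCongr e : Msub C₁ ≃ₗ[RUV] Msub C₂).toLinearMap := by
  refine ⟨(Finsupp.domLCongr e : Msub C₁ ≃ₗ[RUV] Msub C₂).bijective, fun x => ?_, fun i j => ?_⟩
  · have hcomp : (Finsupp.domLCongr e : Msub C₁ ≃ₗ[RUV] Msub C₂).toLinearMap ∘ₗ dmap C₁ =
        dmap C₂ ∘ₗ (Finsupp.domLCongr e : Msub C₁ ≃ₗ[RUV] Msub C₂).toLinearMap := by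
      refine Finsupp.lhom_ext' fun i => LinearMap.ext_ring ?_
      simp only [LinearMap.comp_apply, LinearEquiv.coe_coe, Finsupp.lsingle_apply, dmap,
        Finsupp.domLCongr_single, Finsupp.linearCombination_single, one_smul, map_sum]
      rw [← Equiv.sum_comp e]
      simp only [hdm]
    exact LinearMap.congr_fun hcomp x
  · rw [LinearEquiv.coe_coe, Finsupp.domLCongr_single]
    by_cases h : e i = j
    · subst h
      exact Or.inr (Or.inl ⟨0, by simp, by simp [hgr], by simp [hgr]⟩)
    · exact Or.inl (Finsupp.single_eq_of_ne' h)

lemma stepShift_neg (k : ℕ) {b : ℤ} (hb : b ≠ 0) : stepShift k (-b) = -stepShift k b := by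
  rcases lt_or_gt_of_ne hb with h | h
  · have h' : ¬ -b < 0 := by lia
    simp only [stepShift, h, h', if_true, if_false, Int.natAbs_neg]
    split_ifs <;> simp
  · have h' : -b < 0 := by lia
    have h'' : ¬ b < 0 := by lia
    simp only [stepShift, h', h'', if_true, if_false, Int.natAbs_neg]
    split_ifs <;> simp

lemma getD_map_neg (L : List ℤ) (k : ℕ) : (L.map fun b => -b).getD k 0 = -L.getD k 0 := by
  simpa using List.getD_map (l := L) (d := 0) (n := k) (fun b : ℤ => -b)

lemma grRel_map_neg {L : List ℤ} (hL : ∀ b ∈ L, b ≠ 0) {i : ℕ} (hi : i ≤ L.length) :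
    grRel (L.map fun b => -b) i = -grRel L i := by
  rw [grRel, grRel, ← Finset.sum_neg_distrib]
  refine Finset.sum_congr rfl fun k hk => ?_
  have hk' : k < L.length := (Finset.mem_range.mp hk).trans_le hi
  rw [getD_map_neg, stepShift_neg]
  rw [List.getD_eq_getElem _ _ hk']
  exact hL _ (List.getElem_mem hk')

lemma stdGr_map_neg {L : List ℤ} (hL : ∀ b ∈ L, b ≠ 0) (i : Fin (L.length + 1))
    (j : Fin ((L.map fun b => -b).length + 1)) (hij : (j : ℕ) = i) :
    stdGr (L.map fun b => -b) j = -stdGr L i := by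
  rw [stdGr, stdGr, hij, List.length_map, grRel_map_neg hL (Nat.le_of_lt_succ i.isLt),
    grRel_map_neg hL le_rfl]
  ext <;> simp; ring

lemma stdDm_map_neg (L : List ℤ) (i j : Fin (L.length + 1))
    (i' j' : Fin ((L.map fun b => -b).length + 1)) (hi : (i' : ℕ) = i) (hj : (j' : ℕ) = j) :
    stdDm (L.map fun b => -b) i' j' = stdDm L j i := by
  simp only [stdDm, hi, hj, getD_map_neg, Int.natAbs_neg, neg_lt_zero, neg_pos]
  split_ifs <;> first | rfl | lia

/-- The dual complex `C(b_1, …, b_n)^∨ = Hom_R(C(b_1, …, b_n), R)` of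
a standard complex is isomorphic, as a bigraded chain complex over `R`, to the standard
complex `C(-b_1, …, -b_n)`. -/
theorem dual_of_standard_complex (L : List ℤ) (hL : IsStdSeq L) :
    ∃ f : Msub (dualCx (StdCx L)) →ₗ[RUV] Msub (StdCx (L.map fun b => -b)),
      IsBigradedChainIso (dualCx (StdCx L)) (StdCx (L.map fun b => -b)) f := by
  have hn : (dualCx (StdCx L)).n = (StdCx (L.map fun b => -b)).n := by
    simp [dualCx, StdCx]
  exact ⟨_, isBigradedChainIso_domLCongr (finCongr hn)
    (fun i => stdGr_map_neg hL.1 i _ rfl) (fun i j => stdDm_map_neg L i j _ _ rfl rfl)⟩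
end

section
/- Let C_1 = C(a_1,…,a_m) and C_2 = C(b_1,…,b_n) be standard complexes with preferred bases {x_i} and {y_i}, respectively. Suppose that a_i = b_i for all 1 ≤ i ≤ k and that f: C_1 → C_2 is a local map. Then for all 0 ≤ i ≤ k, f(x_i) is supported by y_i, i.e. the coefficient of y_i when f(x_i) is written in the preferred R-basis of C_2 is nonzero. -/
/-!
Common setup: the ring `R = 𝔽₂[U,V]/(UV = 0)`, bigraded free finitely generated chain
complexes over `R` ("pre-complexes"), knot-like complexes, local maps and local
equivalence, standard and semistandard complexes, short maps, the `Z^!` order,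
the invariants `a_i`, `φ_j`, `P`, shift maps, tensor products, duals, and direct sums.
-/

set_option synthInstance.maxHeartbeats 1000000
set_option maxHeartbeats 1000000

open Polynomial in
/-- The quotient map `R → 𝔽₂[X]` killing `V` if `p` is even and `U` if `p` is odd. -/
noncomputable def axisHom (p : ℕ) : RUV →+* (ZMod 2)[X] :=
  Ideal.Quotient.lift IUV
    (MvPolynomial.aeval (R := ZMod 2) fun s : Fin 2 =>
      if (s : ℕ) = p % 2 then (X : (ZMod 2)[X]) else 0).toRingHom (by
    intro a ha
    obtain ⟨c, rfl⟩ := Ideal.mem_span_singleton'.mp ha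
    rcases Nat.mod_two_eq_zero_or_one p with h | h <;> simp [h])

open Polynomial in
theorem axisHom_U (p : ℕ) : axisHom p Uv = if p % 2 = 0 then (X : (ZMod 2)[X]) else 0 := by
  rcases Nat.mod_two_eq_zero_or_one p with h | h <;> simp [axisHom, Uv, h]

open Polynomial in
theorem axisHom_V (p : ℕ) : axisHom p Vv = if p % 2 = 0 then 0 else (X : (ZMod 2)[X]) := by
  rcases Nat.mod_two_eq_zero_or_one p with h | h <;> simp [axisHom, Vv, h]

open Polynomial in
theorem axisHom_arrow (p q : ℕ) :
    axisHom p (if q % 2 = 0 then Uv else Vv) =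
      if p % 2 = q % 2 then (X : (ZMod 2)[X]) else 0 := by
  rcases Nat.mod_two_eq_zero_or_one p with h | h <;>
  rcases Nat.mod_two_eq_zero_or_one q with h' | h' <;> simp [axisHom_U, axisHom_V, h, h']

/-- Both axis projections have the same constant term. -/
theorem coeff_zero_axisHom (p q : ℕ) (r : RUV) :
    (axisHom p r).coeff 0 = (axisHom q r).coeff 0 := by
  have key : (Polynomial.constantCoeff.comp (axisHom p)).comp (Ideal.Quotient.mk IUV) =
      (Polynomial.constantCoeff.comp (axisHom q)).comp (Ideal.Quotient.mk IUV) := by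
    apply MvPolynomial.ringHom_ext
    · intro a
      simp [axisHom]
    · intro i
      simp only [axisHom, RingHom.comp_apply, Ideal.Quotient.lift_mk, AlgHom.toRingHom_eq_coe,
        RingHom.coe_coe, MvPolynomial.aeval_X]
      split_ifs <;> simp
  obtain ⟨P, rfl⟩ := Ideal.Quotient.mk_surjective r
  simpa using RingHom.congr_fun key P

/-- The kernel of the projection onto the `V`-axis is generated by `U`. -/
theorem axisHom_one_eq_zero_iff (r : RUV) : axisHom 1 r = 0 ↔ ∃ s, r = Uv * s := by
  constructor
  · intro h
    have key : ∀ r : RUV, ∃ s, r = Polynomial.eval₂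
        ((Ideal.Quotient.mk IUV).comp MvPolynomial.C) Vv (axisHom 1 r) + Uv * s := by
      intro r
      obtain ⟨P, rfl⟩ := Ideal.Quotient.mk_surjective r
      induction P using MvPolynomial.induction_on with
      | C a => exact ⟨0, by simp [axisHom]⟩
      | add P Q hP hQ =>
        obtain ⟨s, hs⟩ := hP
        obtain ⟨t, ht⟩ := hQ
        refine ⟨s + t, ?_⟩
        rw [map_add, map_add, Polynomial.eval₂_add]
        linear_combination hs + ht
      | mul_X P i hP =>
        obtain ⟨s, hs⟩ := hP
        rw [map_mul, map_mul, Polynomial.eval₂_mul]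
        fin_cases i
        · refine ⟨Ideal.Quotient.mk IUV P, ?_⟩
          change _ * Uv = _ * Polynomial.eval₂ _ _ (axisHom 1 Uv) + _
          rw [axisHom_U]
          simp [mul_comm]
        · refine ⟨s * Vv, ?_⟩
          change _ * Vv = _ * Polynomial.eval₂ _ _ (axisHom 1 Vv) + _
          rw [axisHom_V]
          simp only [Nat.one_mod, one_ne_zero, if_false, Polynomial.eval₂_X]
          linear_combination Vv * hs
    obtain ⟨s, hs⟩ := key r
    exact ⟨s, by simpa [h] using hs⟩
  · rintro ⟨s, rfl⟩
    simp [axisHom_U]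

theorem mem_uSub_iff {C : PreCx} (x : Msub C) : x ∈ uSub C ↔ ∀ j, axisHom 1 (x j) = 0 := by
  simp only [axisHom_one_eq_zero_iff, uSub, LinearMap.mem_range, LinearMap.lsmul_apply]
  constructor
  · rintro ⟨y, rfl⟩ j
    exact ⟨y j, by simp⟩
  · intro h
    choose s hs using h
    refine ⟨Finsupp.equivFunOnFinite.symm s, ?_⟩
    ext j
    simp [hs j]

theorem linearMap_apply_eq_sum {m n : ℕ} (f : (Fin m →₀ RUV) →ₗ[RUV] (Fin n →₀ RUV))
    (x : Fin m →₀ RUV) (l : Fin n) : f x l = ∑ j, x j * f (Finsupp.single j 1) l := by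
  have hx : x = ∑ j, x j • Finsupp.single j (1 : RUV) := by
    simp [Finsupp.univ_sum_single]
  conv_lhs => rw [hx, map_sum, Finsupp.finsetSum_apply]
  simp only [map_smul, Finsupp.smul_apply, smul_eq_mul]

theorem dmap_single_apply (C : PreCx) (i j : Fin C.n) :
    dmap C (Finsupp.single i 1) j = C.dm i j := by
  simp [dmap, Finsupp.single_apply]

theorem dmap_apply (C : PreCx) (x : Msub C) (l : Fin C.n) :
    dmap C x l = ∑ j, x j * C.dm j l := by
  rw [linearMap_apply_eq_sum]
  simp only [dmap_single_apply]

section StandardComplex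

/-- The index of the generator `x_p` of a standard complex. -/
def stdIdx (L : List ℤ) (p : ℕ) (hp : p ≤ L.length) : Fin (StdCx L).n :=
  ⟨p, Nat.lt_succ_of_le hp⟩

theorem stdIdx_val (L : List ℤ) (p : ℕ) (hp : p ≤ L.length) : (stdIdx L p hp : ℕ) = p := rfl

variable {L : List ℤ}

open Polynomial in
theorem axisHom_stdCx_dm (p : ℕ) (i j : Fin (StdCx L).n) :
    axisHom p ((StdCx L).dm i j) =
      if (j : ℕ) = i + 1 ∧ L.getD i 0 < 0 ∧ p % 2 = i % 2 then
        (X : (ZMod 2)[X]) ^ (L.getD i 0).natAbs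
      else if (i : ℕ) = j + 1 ∧ 0 < L.getD j 0 ∧ p % 2 = j % 2 then
        X ^ (L.getD j 0).natAbs
      else 0 := by
  simp only [StdCx, stdDm]
  have hz : ∀ a : ℤ, a ≠ 0 → (0 : (ZMod 2)[X]) ^ a.natAbs = 0 := fun a ha =>
    zero_pow (by omega)
  by_cases h1 : (j : ℕ) = i + 1 ∧ L.getD i 0 < 0
  · rw [if_pos h1, map_pow, axisHom_arrow]
    by_cases hp : p % 2 = i % 2
    · rw [if_pos hp, if_pos ⟨h1.1, h1.2, hp⟩]
    · rw [if_neg hp, hz _ (by omega), if_neg (by tauto), if_neg (by omega)]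
  · rw [if_neg h1, if_neg (c := (j : ℕ) = i + 1 ∧ L.getD i 0 < 0 ∧ p % 2 = i % 2) (by tauto)]
    by_cases h2 : (i : ℕ) = j + 1 ∧ 0 < L.getD j 0
    · rw [if_pos h2, map_pow, axisHom_arrow]
      by_cases hp : p % 2 = j % 2
      · rw [if_pos hp, if_pos ⟨h2.1, h2.2, hp⟩]
      · rw [if_neg hp, hz _ (by omega), if_neg (by tauto)]
    · rw [if_neg h2, if_neg (by tauto), map_zero]

theorem axisHom_dmap_apply (p : ℕ) (x : Msub (StdCx L)) (l : Fin (StdCx L).n) :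
    axisHom p (dmap (StdCx L) x l) =
      ∑ j, axisHom p (x j) * axisHom p ((StdCx L).dm j l) := by
  rw [dmap_apply, map_sum]
  simp only [map_mul]

open Polynomial in
/-- Across a negative parameter, the differential along the axis of that parameter sends the
coefficient at `x_p` to the coefficient at `x_{p+1}`. -/
theorem axisHom_dmap_of_neg {p : ℕ} (hp : p < L.length) (hneg : L.getD p 0 < 0)
    (x : Msub (StdCx L)) :
    axisHom p (dmap (StdCx L) x (stdIdx L (p + 1) (by omega))) =
      axisHom p (x (stdIdx L p (by omega))) * X ^ (L.getD p 0).natAbs := by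
  rw [axisHom_dmap_apply, Finset.sum_eq_single (stdIdx L p (by omega))]
  · rw [axisHom_stdCx_dm, if_pos ⟨rfl, hneg, rfl⟩, stdIdx_val]
  · intro j _ hj
    have hj' : (j : ℕ) ≠ p := fun h => hj (Fin.ext h)
    rw [axisHom_stdCx_dm, if_neg (by simp only [stdIdx_val]; omega), if_neg (by simp only [stdIdx_val]; omega), mul_zero]
  · simp

open Polynomial in
/-- Across a positive parameter, the differential along the axis of that parameter sends the
coefficient at `x_{p+1}` to the coefficient at `x_p`. -/
theorem axisHom_dmap_of_pos {p : ℕ} (hp : p < L.length) (hpos : 0 < L.getD p 0)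
    (x : Msub (StdCx L)) :
    axisHom p (dmap (StdCx L) x (stdIdx L p (by omega))) =
      axisHom p (x (stdIdx L (p + 1) (by omega))) * X ^ (L.getD p 0).natAbs := by
  rw [axisHom_dmap_apply, Finset.sum_eq_single (stdIdx L (p + 1) (by omega))]
  · rw [axisHom_stdCx_dm, if_neg (by simp only [stdIdx_val]; omega), if_pos ⟨rfl, hpos, rfl⟩, stdIdx_val]
  · intro j _ hj
    have hj' : (j : ℕ) ≠ p + 1 := fun h => hj (Fin.ext h)
    rw [axisHom_stdCx_dm, if_neg (by simp only [stdIdx_val]; omega), if_neg (by simp only [stdIdx_val]; omega), mul_zero]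
  · simp

open Polynomial in
theorem axisHom_map_dmap_single_of_neg {L' : List ℤ} {p : ℕ} (hp : p < L.length)
    (hneg : L.getD p 0 < 0) (f : Msub (StdCx L) →ₗ[RUV] Msub (StdCx L'))
    (l : Fin (StdCx L').n) :
    axisHom p (f (dmap (StdCx L)
        (Finsupp.single (stdIdx L p (by omega)) 1)) l) =
      X ^ (L.getD p 0).natAbs *
        axisHom p (f (Finsupp.single (stdIdx L (p + 1) (by omega)) 1) l) := by
  rw [linearMap_apply_eq_sum, map_sum,
    Finset.sum_eq_single (stdIdx L (p + 1) (by omega)), map_mul, dmap_single_apply]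
  · rw [axisHom_stdCx_dm, if_pos ⟨rfl, hneg, rfl⟩, stdIdx_val]
  · intro j _ hj
    have hj' : (j : ℕ) ≠ p + 1 := fun h => hj (Fin.ext h)
    rw [dmap_single_apply, map_mul]
    rw [axisHom_stdCx_dm, if_neg (by simp only [stdIdx_val]; omega), if_neg (by simp only [stdIdx_val]; omega), zero_mul]
  · exact fun h => absurd (Finset.mem_univ _) h

open Polynomial in
theorem axisHom_map_dmap_single_of_pos {L' : List ℤ} {p : ℕ} (hp : p < L.length)
    (hpos : 0 < L.getD p 0) (f : Msub (StdCx L) →ₗ[RUV] Msub (StdCx L'))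
    (l : Fin (StdCx L').n) :
    axisHom p (f (dmap (StdCx L)
        (Finsupp.single (stdIdx L (p + 1) (by omega)) 1)) l) =
      X ^ (L.getD p 0).natAbs *
        axisHom p (f (Finsupp.single (stdIdx L p (by omega)) 1) l) := by
  rw [linearMap_apply_eq_sum, map_sum,
    Finset.sum_eq_single (stdIdx L p (by omega)), map_mul, dmap_single_apply]
  · rw [axisHom_stdCx_dm, if_neg (by simp only [stdIdx_val]; omega), if_pos ⟨rfl, hpos, rfl⟩, stdIdx_val]
  · intro j _ hj
    have hj' : (j : ℕ) ≠ p := fun h => hj (Fin.ext h)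
    rw [dmap_single_apply, map_mul]
    rw [axisHom_stdCx_dm, if_neg (by simp only [stdIdx_val]; omega), if_neg (by simp only [stdIdx_val]; omega), zero_mul]
  · exact fun h => absurd (Finset.mem_univ _) h

/-- The initial generator `x_0` of a standard complex. -/
noncomputable abbrev stdOrigin (L : List ℤ) : Msub (StdCx L) :=
  Finsupp.single (stdIdx L 0 (Nat.zero_le _)) 1

theorem dmap_stdOrigin_mem_uSub : dmap (StdCx L) (stdOrigin L) ∈ uSub (StdCx L) := by
  rw [mem_uSub_iff]
  intro j
  rw [dmap_single_apply]
  rw [axisHom_stdCx_dm, if_neg (by simp [stdIdx_val]), if_neg (by simp [stdIdx_val])]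

/-- The coefficient of `x_0` along the `V`-axis vanishes on boundaries of `C/U`. -/
theorem axisHom_origin_eq_zero_of_mem_bdryU {x : Msub (StdCx L)} (hx : x ∈ bdryU (StdCx L)) :
    axisHom 1 (x (stdIdx L 0 (Nat.zero_le _))) = 0 := by
  obtain ⟨y, hy, _, ⟨z, rfl⟩, rfl⟩ := Submodule.mem_sup.mp hx
  rw [Finsupp.add_apply, map_add, (mem_uSub_iff y).mp hy, zero_add, axisHom_dmap_apply]
  refine Finset.sum_eq_zero fun j _ => ?_
  rw [axisHom_stdCx_dm, if_neg (by simp [stdIdx_val]), if_neg (by simp [stdIdx_val]), mul_zero]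

theorem axisHom_single_eq_zero {C : PreCx} {j : Fin C.n} {r : RUV} (h : axisHom 1 r = 0) :
    (Finsupp.single j r : Msub C) ∈ uSub C := by
  rw [mem_uSub_iff]
  intro i
  rw [Finsupp.single_apply]
  split_ifs <;> simp [h]

theorem axisHom_eq_of_mod_two_eq {p q : ℕ} (h : p % 2 = q % 2) : axisHom p = axisHom q := by
  unfold axisHom
  simp only [h]

/-- If the `V`-part of `∂ x_i` is `V^a x_j`, then `V^a x_j` bounds in `C/U`. -/
theorem pow_smul_single_mem_bdryU {i j : Fin (StdCx L).n} {a : ℕ}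
    (h : ∀ l : Fin (StdCx L).n, axisHom 1 ((StdCx L).dm i l) =
      if l = j then Polynomial.X ^ a else 0) (r : RUV) :
    Vv ^ a • (Finsupp.single j r : Msub (StdCx L)) ∈ bdryU (StdCx L) := by
  have hsum : Vv ^ a • (Finsupp.single j r : Msub (StdCx L)) =
      (Vv ^ a • (Finsupp.single j r : Msub (StdCx L)) -
        dmap (StdCx L) (Finsupp.single i r)) + dmap (StdCx L) (Finsupp.single i r) := by abel
  rw [hsum]
  refine Submodule.add_mem_sup ?_ ⟨_, rfl⟩
  rw [mem_uSub_iff]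
  intro l
  have hr : (Finsupp.single i r : Msub (StdCx L)) = r • Finsupp.single i 1 := by simp
  rw [Finsupp.sub_apply, map_sub, hr, map_smul, Finsupp.smul_apply, Finsupp.smul_apply,
    dmap_single_apply]
  rw [smul_eq_mul, smul_eq_mul, map_mul, map_mul, h l, Finsupp.single_apply]
  by_cases hl : l = j
  · subst hl
    simp [axisHom_V, mul_comm]
  · rw [if_neg hl, if_neg (fun e => hl e.symm)]
    simp

/-- Away from `x_0`, the homology of `C/U` is `V`-torsion. -/
theorem exists_pow_smul_single_mem_bdryU (hL : IsStdSeq L) {z : Msub (StdCx L)}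
    (hz : dmap (StdCx L) z ∈ uSub (StdCx L)) (j : Fin (StdCx L).n) (hj0 : (j : ℕ) ≠ 0) :
    ∃ a : ℕ, Vv ^ a • (Finsupp.single j (z j) : Msub (StdCx L)) ∈ bdryU (StdCx L) := by
  rw [mem_uSub_iff] at hz
  have hjlt : (j : ℕ) < L.length + 1 := j.isLt
  obtain ⟨c, hc⟩ := hL.2
  have hmem : axisHom 1 (z j) = 0 →
      ∃ a : ℕ, Vv ^ a • (Finsupp.single j (z j) : Msub (StdCx L)) ∈ bdryU (StdCx L) :=
    fun h => ⟨0, by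
      rw [pow_zero, one_smul]
      exact Submodule.mem_sup_left (axisHom_single_eq_zero h)⟩
  obtain ⟨p, hp, hpodd, hpj⟩ :
      ∃ p, p < L.length ∧ p % 2 = 1 ∧ ((j : ℕ) = p ∨ (j : ℕ) = p + 1) := by
    rcases Nat.mod_two_eq_zero_or_one j with h | h
    · exact ⟨j - 1, by omega, by omega, by omega⟩
    · exact ⟨j, by omega, by omega, by omega⟩
  have hax : axisHom p = axisHom 1 := axisHom_eq_of_mod_two_eq (by omega)
  have hne : L.getD p 0 ≠ 0 := by
    rw [List.getD_eq_getElem _ _ hp]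
    exact hL.1 _ (List.getElem_mem hp)
  rcases lt_or_gt_of_ne hne with hneg | hpos
  · rcases hpj with h | h
    · have := axisHom_dmap_of_neg hp hneg z
      rw [hax, hz] at this
      rw [show stdIdx L p _ = j from Fin.ext h.symm] at this
      exact hmem ((mul_eq_zero.mp this.symm).resolve_right (pow_ne_zero _ Polynomial.X_ne_zero))
    · refine ⟨(L.getD p 0).natAbs,
        pow_smul_single_mem_bdryU (i := stdIdx L p (by omega)) (fun l => ?_) _⟩
      rw [axisHom_stdCx_dm]
      by_cases hl : l = j
      · rw [if_pos hl, if_pos ⟨by rw [hl, h, stdIdx_val], hneg, by simp only [stdIdx_val]; omega⟩,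
          stdIdx_val]
      · have hl' : (l : ℕ) ≠ p + 1 := fun e => hl (Fin.ext (e.trans h.symm))
        rw [if_neg hl, if_neg (by simp only [stdIdx_val]; omega), if_neg (by simp only [stdIdx_val]; omega)]
  · rcases hpj with h | h
    · refine ⟨(L.getD p 0).natAbs,
        pow_smul_single_mem_bdryU (i := stdIdx L (p + 1) (by omega)) (fun l => ?_) _⟩
      rw [axisHom_stdCx_dm, if_neg (by simp only [stdIdx_val]; omega)]
      by_cases hl : l = j
      · rw [if_pos hl, if_pos ⟨by rw [hl, h, stdIdx_val], by rw [hl, h]; exact hpos, by rw [hl, h]; omega⟩,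
          hl, h]
      · have hl' : (l : ℕ) ≠ p := fun e => hl (Fin.ext (e.trans h.symm))
        rw [if_neg hl, if_neg (by simp only [stdIdx_val]; omega)]
    · have := axisHom_dmap_of_pos hp hpos z
      rw [hax, hz] at this
      rw [show stdIdx L (p + 1) _ = j from Fin.ext h.symm] at this
      exact hmem ((mul_eq_zero.mp this.symm).resolve_right (pow_ne_zero _ Polynomial.X_ne_zero))

theorem isVTowerGen_stdOrigin (hL : IsStdSeq L) : IsVTowerGen (StdCx L) (stdOrigin L) := by
  refine ⟨dmap_stdOrigin_mem_uSub, fun k hk => ?_, fun z hz => ?_⟩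
  · have := axisHom_origin_eq_zero_of_mem_bdryU hk
    rw [Finsupp.smul_apply, Finsupp.single_eq_same, smul_eq_mul, mul_one, map_pow,
      axisHom_V] at this
    exact pow_ne_zero k Polynomial.X_ne_zero this
  · have htors : ∀ j : Fin (StdCx L).n, ∃ a : ℕ, (j : ℕ) ≠ 0 →
        Vv ^ a • (Finsupp.single j (z j) : Msub (StdCx L)) ∈ bdryU (StdCx L) := by
      intro j
      by_cases hj : (j : ℕ) = 0
      · exact ⟨0, fun h => absurd hj h⟩
      · obtain ⟨a, ha⟩ := exists_pow_smul_single_mem_bdryU hL hz j hj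
        exact ⟨a, fun _ => ha⟩
    choose a ha using htors
    refine ⟨z (stdIdx L 0 (Nat.zero_le _)), ∑ j, a j, ?_⟩
    have hdecomp : z - z (stdIdx L 0 (Nat.zero_le _)) • stdOrigin L =
        ∑ j ∈ Finset.univ.erase (stdIdx L 0 (Nat.zero_le _)), Finsupp.single j (z j) := by
      rw [sub_eq_iff_eq_add', Finsupp.smul_single_one,
        Finset.add_sum_erase _ (fun j => Finsupp.single j (z j)) (Finset.mem_univ _),
        Finsupp.univ_sum_single]
    rw [hdecomp, Finset.smul_sum]
    refine Submodule.sum_mem _ fun j hj => ?_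
    rw [← Finset.sum_erase_add _ _ (Finset.mem_univ j), pow_add, mul_smul]
    exact Submodule.smul_mem _ _ (ha _ fun h => Finset.ne_of_mem_erase hj (Fin.ext h))

/-- A `V`-tower generator is supported by `x_0` with nonzero constant coefficient. -/
theorem IsVTowerGen.coeff_zero_origin_ne_zero {x : Msub (StdCx L)}
    (hx : IsVTowerGen (StdCx L) x) :
    (axisHom 1 (x (stdIdx L 0 (Nat.zero_le _)))).coeff 0 ≠ 0 := by
  obtain ⟨r, k, h⟩ := hx.2.2 _ dmap_stdOrigin_mem_uSub
  have h0 := axisHom_origin_eq_zero_of_mem_bdryU h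
  intro hx0
  rw [Finsupp.smul_apply, Finsupp.sub_apply, Finsupp.smul_apply, smul_eq_mul, smul_eq_mul,
    map_mul, map_sub, map_mul, map_pow, axisHom_V] at h0
  have h1 := (mul_eq_zero.mp h0).resolve_left (by simp)
  have h2 := congrArg (fun P => Polynomial.coeff P 0) h1
  simp [stdOrigin, Polynomial.mul_coeff_zero, hx0] at h2

end StandardComplex

/-- A chain map between standard complexes has the same diagonal coefficients, along the axis
of a common parameter, at the two ends of that parameter's arrow. -/
theorem axisHom_diagonal_succ {L₁ L₂ : List ℤ} {f : Msub (StdCx L₁) →ₗ[RUV] Msub (StdCx L₂)}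
    (hf : ∀ x, f (dmap (StdCx L₁) x) = dmap (StdCx L₂) (f x)) {p : ℕ}
    (hp₁ : p < L₁.length) (hp₂ : p < L₂.length) (hne : L₁.getD p 0 ≠ 0)
    (heq : L₁.getD p 0 = L₂.getD p 0) :
    axisHom p (f (Finsupp.single (stdIdx L₁ (p + 1) (by omega)) 1)
        (stdIdx L₂ (p + 1) (by omega))) =
      axisHom p (f (Finsupp.single (stdIdx L₁ p (by omega)) 1)
        (stdIdx L₂ p (by omega))) := by
  have hX : (Polynomial.X : Polynomial (ZMod 2)) ^ (L₁.getD p 0).natAbs ≠ 0 :=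
    pow_ne_zero _ Polynomial.X_ne_zero
  rcases lt_or_gt_of_ne hne with hneg | hpos
  · have h1 := axisHom_map_dmap_single_of_neg hp₁ hneg f (stdIdx L₂ (p + 1) (by omega))
    rw [hf, axisHom_dmap_of_neg hp₂ (heq ▸ hneg), ← heq, mul_comm] at h1
    exact (mul_left_cancel₀ hX h1).symm
  · have h1 := axisHom_map_dmap_single_of_pos hp₁ hpos f (stdIdx L₂ p (by omega))
    rw [hf, axisHom_dmap_of_pos hp₂ (heq ▸ hpos), ← heq, mul_comm] at h1
    exact mul_left_cancel₀ hX h1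

/-- Let `C₁ = C(a_1, …, a_m)` and `C₂ = C(b_1, …, b_n)` be standard
complexes with preferred bases `{x_i}` and `{y_i}`.  Suppose `a_i = b_i` for
`1 ≤ i ≤ k` and `f : C₁ → C₂` is a local map.  Then for all `0 ≤ i ≤ k`, `f(x_i)` is
supported by `y_i`: the coefficient of `y_i` in `f(x_i)` is nonzero. -/
theorem local_map_supported_on_matching_generators
    (L₁ L₂ : List ℤ) (h₁ : IsStdSeq L₁) (h₂ : IsStdSeq L₂)
    (k : ℕ) (hk₁ : k ≤ L₁.length) (hk₂ : k ≤ L₂.length)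
    (hagree : ∀ i < k, L₁.getD i 0 = L₂.getD i 0)
    (f : Msub (StdCx L₁) →ₗ[RUV] Msub (StdCx L₂))
    (hf : IsLocalMap (StdCx L₁) (StdCx L₂) f) :
    ∀ i : ℕ, ∀ hi : i ≤ k,
      f (Finsupp.single (⟨i, by omega⟩ : Fin (L₁.length + 1)) 1)
        (⟨i, by omega⟩ : Fin (L₂.length + 1)) ≠ 0 := by
  suffices H : ∀ i : ℕ, ∀ hi : i ≤ k,
      (axisHom 1 (f (Finsupp.single (stdIdx L₁ i (by omega)) 1)
        (stdIdx L₂ i (by omega)))).coeff 0 ≠ 0 by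
    intro i hi h
    refine H i hi ?_
    rw [show f (Finsupp.single (stdIdx L₁ i _) 1) (stdIdx L₂ i _) = 0 from h, map_zero,
      Polynomial.coeff_zero]
  intro i
  induction i with
  | zero =>
    intro _
    exact (hf.towers _ (isVTowerGen_stdOrigin h₁)).coeff_zero_origin_ne_zero
  | succ p ih =>
    intro hi
    have hp₁ : p < L₁.length := by omega
    have hne : L₁.getD p 0 ≠ 0 := by
      rw [List.getD_eq_getElem _ _ hp₁]
      exact h₁.1 _ (List.getElem_mem hp₁)
    rw [coeff_zero_axisHom 1 p,
      axisHom_diagonal_succ hf.chain hp₁ (by omega) hne (hagree p (by omega)),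
      coeff_zero_axisHom p 1]
    exact ih (by omega)
end
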